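/- Let 0 < α_1 < α_2 be real numbers, let P be a probability vector on n points, and let k be a positive integer with k + 1 ≤ n and log k ≤ H_{α_1}(P) < log(k+1). Then there exists s ∈ [0,1] such that the mixture Q = s·U_k + (1−s)·U_{k+1} satisfies H_{α_1}(Q) = H_{α_1}(P) and H_{α_2}(P) ≤ H_{α_2}(Q). That is, the upper bound on H_{α_2}(P) given H_{α_1}(P) is attained by a mixture of uniform distributions on k and k+1 points. -/

import Mathlib

open Real Filter

/-- Rényi entropy of order `α` of a vector `p` on `n` points (order 1 = Shannon entropy). -/
noncomputable def renyiH {n : ℕ} (α : ℝ) (p : Fin n → ℝ) : ℝ :=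
  if α = 1 then -∑ i, p i * Real.log (p i)
  else (1 / (1 - α)) * Real.log (∑ i, p i ^ α)

/-- `unif n k` : probability vector on `n` points with `k` coordinates equal to `1/k`
and the remaining coordinates equal to `0`. -/
noncomputable def unif (n k : ℕ) : Fin n → ℝ :=
  fun i => if (i : ℕ) < k then (k : ℝ)⁻¹ else 0

/-- A convex function whose sum over a probability vector is a strictly decreasing function of the
Rényi entropy of order `α`, normalised so that its second derivative is `x ^ (α - 2)`. -/
noncomputable def renyiConvex (α x : ℝ) : ℝ :=
  if α = 1 then x * Real.log x - x else x ^ α / (α * (α - 1))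

/-- The derivative of `renyiConvex α`. -/
noncomputable def renyiSlope (α x : ℝ) : ℝ :=
  if α = 1 then Real.log x else x ^ (α - 1) / (α - 1)

theorem continuous_renyiConvex {α : ℝ} (hα : 0 < α) : Continuous (renyiConvex α) := by
  unfold renyiConvex
  split_ifs
  · exact Real.continuous_mul_log.sub continuous_id
  · exact (Real.continuous_rpow_const hα.le).div_const _

theorem hasDerivAt_renyiConvex {α x : ℝ} (hα : 0 < α) (hx : 0 < x) :
    HasDerivAt (renyiConvex α) (renyiSlope α x) x := by
  unfold renyiConvex renyiSlope
  split_ifs with h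
  · exact ((Real.hasDerivAt_mul_log hx.ne').sub (hasDerivAt_id x)).congr_deriv (by ring)
  · refine ((Real.hasDerivAt_rpow_const (p := α) (Or.inl hx.ne')).div_const
      (α * (α - 1))).congr_deriv ?_
    have : α - 1 ≠ 0 := sub_ne_zero.2 h
    field_simp

theorem hasDerivAt_renyiSlope {α x : ℝ} (hx : 0 < x) :
    HasDerivAt (renyiSlope α) (x ^ (α - 2)) x := by
  unfold renyiSlope
  split_ifs with h
  · refine (Real.hasDerivAt_log hx.ne').congr_deriv ?_
    rw [h, show (1 : ℝ) - 2 = -1 by norm_num, Real.rpow_neg_one]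
  · refine ((Real.hasDerivAt_rpow_const (p := α - 1) (Or.inl hx.ne')).div_const
      (α - 1)).congr_deriv ?_
    have : α - 1 ≠ 0 := sub_ne_zero.2 h
    rw [show α - 1 - 1 = α - 2 by ring]
    field_simp

/-- The tangent line inequality for `renyiConvex α`. -/
theorem renyiConvex_tangent_le {α a x : ℝ} (hα : 0 < α) (ha : 0 < a) (hx : 0 ≤ x) :
    renyiConvex α a - renyiSlope α a * a ≤ renyiConvex α x - renyiSlope α a * x := by
  have hcont : Continuous fun y => renyiConvex α y - renyiSlope α a * y :=
    (continuous_renyiConvex hα).sub (continuous_const.mul continuous_id)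
  have hder : ∀ y, 0 < y → HasDerivAt (fun y => renyiConvex α y - renyiSlope α a * y)
      (renyiSlope α y - renyiSlope α a) y := fun y hy => by
    exact ((hasDerivAt_renyiConvex hα hy).sub
      ((hasDerivAt_id y).const_mul (renyiSlope α a))).congr_deriv (by rw [mul_one])
  have hmono : MonotoneOn (renyiSlope α) (Set.Ioi 0) := by
    refine monotoneOn_of_hasDerivWithinAt_nonneg (f' := fun y => y ^ (α - 2)) (convex_Ioi 0)
      (fun y hy => (hasDerivAt_renyiSlope hy).continuousAt.continuousWithinAt) ?_ ?_
    · intro y hy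
      rw [interior_Ioi] at hy
      exact (hasDerivAt_renyiSlope hy).hasDerivWithinAt
    · intro y hy
      rw [interior_Ioi] at hy
      exact Real.rpow_nonneg (le_of_lt hy) _
  rcases le_total x a with h | h
  · have : AntitoneOn (fun y => renyiConvex α y - renyiSlope α a * y) (Set.Icc 0 a) := by
      refine antitoneOn_of_hasDerivWithinAt_nonpos
        (f' := fun y => renyiSlope α y - renyiSlope α a) (convex_Icc 0 a)
        hcont.continuousOn ?_ ?_
      · intro y hy
        rw [interior_Icc] at hy
        exact (hder y hy.1).hasDerivWithinAt
      · intro y hy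
        rw [interior_Icc] at hy
        exact sub_nonpos.2 (hmono hy.1 ha hy.2.le)
    exact this ⟨hx, h⟩ ⟨ha.le, le_rfl⟩ h
  · have : MonotoneOn (fun y => renyiConvex α y - renyiSlope α a * y) (Set.Ici a) := by
      refine monotoneOn_of_hasDerivWithinAt_nonneg
        (f' := fun y => renyiSlope α y - renyiSlope α a) (convex_Ici a)
        hcont.continuousOn ?_ ?_
      · intro y hy
        rw [interior_Ici] at hy
        exact (hder y (ha.trans hy)).hasDerivWithinAt
      · intro y hy
        rw [interior_Ici] at hy
        exact sub_nonneg.2 (hmono ha (ha.trans hy) (le_of_lt hy))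
    exact this Set.self_mem_Ici h h

/-- For `0 < c < a`, some combination of `renyiConvex α₂`, `renyiConvex α₁` and the identity
increases on `[0, c]`, decreases on `[c, a]` and increases on `[a, ∞)`. -/
theorem exists_renyiConvex_combination {α₁ α₂ c a : ℝ} (hα₁ : 0 < α₁) (hα₁₂ : α₁ < α₂)
    (hc : 0 < c) (hca : c < a) :
    ∃ u v : ℝ,
      MonotoneOn (fun x => renyiConvex α₂ x - u * renyiConvex α₁ x - v * x) (Set.Icc 0 c) ∧
      AntitoneOn (fun x => renyiConvex α₂ x - u * renyiConvex α₁ x - v * x) (Set.Icc c a) ∧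
      MonotoneOn (fun x => renyiConvex α₂ x - u * renyiConvex α₁ x - v * x) (Set.Ici a) := by
  have hα₂ : 0 < α₂ := hα₁.trans hα₁₂
  obtain ⟨ξ, ⟨hcξ, hξa⟩, hξ⟩ := exists_ratio_hasDerivAt_eq_ratio_slope
    (renyiSlope α₂) (fun x => x ^ (α₂ - 2)) hca
    (fun x hx => (hasDerivAt_renyiSlope (hc.trans_le hx.1)).continuousAt.continuousWithinAt)
    (fun x hx => hasDerivAt_renyiSlope (hc.trans hx.1))
    (renyiSlope α₁) (fun x => x ^ (α₁ - 2))
    (fun x hx => (hasDerivAt_renyiSlope (hc.trans_le hx.1)).continuousAt.continuousWithinAt)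
    (fun x hx => hasDerivAt_renyiSlope (hc.trans hx.1))
  have hξ0 : 0 < ξ := hc.trans hcξ
  have hsplit : ∀ x : ℝ, 0 < x → x ^ (α₂ - 2) = x ^ (α₂ - α₁) * x ^ (α₁ - 2) := fun x hx => by
    rw [← Real.rpow_add hx]
    congr 1
    ring
  set u : ℝ := ξ ^ (α₂ - α₁) with hu
  set D : ℝ → ℝ := fun x => renyiSlope α₂ x - u * renyiSlope α₁ x with hD
  have hDeq : D c = D a := by
    rw [hsplit ξ hξ0, ← hu] at hξ
    have hpos : 0 < ξ ^ (α₁ - 2) := Real.rpow_pos_of_pos hξ0 _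
    have : u * (renyiSlope α₁ a - renyiSlope α₁ c) = renyiSlope α₂ a - renyiSlope α₂ c :=
      mul_right_cancel₀ hpos.ne' (by linarith)
    simp only [hD]
    linarith
  have hDder : ∀ x, 0 < x → HasDerivAt D ((x ^ (α₂ - α₁) - u) * x ^ (α₁ - 2)) x := fun x hx => by
    refine ((hasDerivAt_renyiSlope hx).sub
      ((hasDerivAt_renyiSlope hx).const_mul u)).congr_deriv ?_
    rw [hsplit x hx]
    ring
  have hDanti : AntitoneOn D (Set.Ioc 0 ξ) := by
    refine antitoneOn_of_hasDerivWithinAt_nonpos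
      (f' := fun x => (x ^ (α₂ - α₁) - u) * x ^ (α₁ - 2)) (convex_Ioc 0 ξ)
      (fun x hx => (hDder x hx.1).continuousAt.continuousWithinAt) ?_ ?_
    · intro x hx
      rw [interior_Ioc] at hx
      exact (hDder x hx.1).hasDerivWithinAt
    · intro x hx
      rw [interior_Ioc] at hx
      exact mul_nonpos_of_nonpos_of_nonneg
        (sub_nonpos.2 (Real.rpow_le_rpow hx.1.le hx.2.le (by linarith)))
        (Real.rpow_nonneg hx.1.le _)
  have hDmono : MonotoneOn D (Set.Ici ξ) := by
    refine monotoneOn_of_hasDerivWithinAt_nonneg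
      (f' := fun x => (x ^ (α₂ - α₁) - u) * x ^ (α₁ - 2)) (convex_Ici ξ)
      (fun x hx => (hDder x (hξ0.trans_le hx)).continuousAt.continuousWithinAt) ?_ ?_
    · intro x hx
      rw [interior_Ici] at hx
      exact (hDder x (hξ0.trans hx)).hasDerivWithinAt
    · intro x hx
      rw [interior_Ici] at hx
      exact mul_nonneg
        (sub_nonneg.2 (Real.rpow_le_rpow hξ0.le (le_of_lt hx) (by linarith)))
        (Real.rpow_nonneg (hξ0.trans hx).le _)
  have hcont : Continuous fun x => renyiConvex α₂ x - u * renyiConvex α₁ x - D a * x :=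
    ((continuous_renyiConvex hα₂).sub (continuous_const.mul (continuous_renyiConvex hα₁))).sub
      (continuous_const.mul continuous_id)
  have hder : ∀ x, 0 < x →
      HasDerivAt (fun x => renyiConvex α₂ x - u * renyiConvex α₁ x - D a * x) (D x - D a) x :=
    fun x hx => by
      exact (((hasDerivAt_renyiConvex hα₂ hx).sub
        ((hasDerivAt_renyiConvex hα₁ hx).const_mul u)).sub
        ((hasDerivAt_id x).const_mul (D a))).congr_deriv (by rw [mul_one])
  refine ⟨u, D a, ?_, ?_, ?_⟩
  · refine monotoneOn_of_hasDerivWithinAt_nonneg (f' := fun x => D x - D a) (convex_Icc 0 c)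
      hcont.continuousOn ?_ ?_
    · intro x hx
      rw [interior_Icc] at hx
      exact (hder x hx.1).hasDerivWithinAt
    · intro x hx
      rw [interior_Icc] at hx
      rw [← hDeq]
      exact sub_nonneg.2 (hDanti ⟨hx.1, (hx.2.trans hcξ).le⟩ ⟨hc, hcξ.le⟩ hx.2.le)
  · refine antitoneOn_of_hasDerivWithinAt_nonpos (f' := fun x => D x - D a) (convex_Icc c a)
      hcont.continuousOn ?_ ?_
    · intro x hx
      rw [interior_Icc] at hx
      exact (hder x (hc.trans hx.1)).hasDerivWithinAt
    · intro x hx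
      rw [interior_Icc] at hx
      refine sub_nonpos.2 ?_
      rcases le_total x ξ with h | h
      · rw [← hDeq]
        exact hDanti ⟨hc, hcξ.le⟩ ⟨hc.trans hx.1, h⟩ hx.1.le
      · exact hDmono h hξa.le hx.2.le
  · refine monotoneOn_of_hasDerivWithinAt_nonneg (f' := fun x => D x - D a) (convex_Ici a)
      hcont.continuousOn ?_ ?_
    · intro x hx
      rw [interior_Ici] at hx
      exact (hder x (hc.trans (hca.trans hx))).hasDerivWithinAt
    · intro x hx
      rw [interior_Ici] at hx
      exact sub_nonneg.2 (hDmono hξa.le (hξa.trans hx).le (le_of_lt hx))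

theorem sum_rpow_pos {n : ℕ} (α : ℝ) {p : Fin n → ℝ} (hp : ∀ i, 0 ≤ p i) (hps : ∑ i, p i = 1) :
    0 < ∑ i, p i ^ α := by
  obtain ⟨i, -, hi⟩ := Finset.exists_ne_zero_of_sum_ne_zero (hps.trans_ne one_ne_zero)
  exact Finset.sum_pos' (fun j _ => Real.rpow_nonneg (hp j) _)
    ⟨i, Finset.mem_univ i, Real.rpow_pos_of_pos ((hp i).lt_of_ne' hi) _⟩

theorem renyiH_le_iff {n : ℕ} {α : ℝ} (hα : 0 < α) {p q : Fin n → ℝ}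
    (hp : ∀ i, 0 ≤ p i) (hps : ∑ i, p i = 1) (hq : ∀ i, 0 ≤ q i) (hqs : ∑ i, q i = 1) :
    renyiH α p ≤ renyiH α q ↔ ∑ i, renyiConvex α (q i) ≤ ∑ i, renyiConvex α (p i) := by
  unfold renyiH renyiConvex
  split_ifs with h
  · rw [Finset.sum_sub_distrib, Finset.sum_sub_distrib, hps, hqs]
    constructor <;> intro h <;> linarith
  · have hP := sum_rpow_pos α hp hps
    have hQ := sum_rpow_pos α hq hqs
    rw [← Finset.sum_div, ← Finset.sum_div]
    rcases lt_or_gt_of_ne h with h | h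
    · rw [mul_le_mul_iff_right₀ (one_div_pos.2 (sub_pos.2 h)), Real.log_le_log_iff hP hQ,
        div_le_div_right_of_neg (mul_neg_of_pos_of_neg hα (sub_neg.2 h))]
    · rw [mul_le_mul_left_of_neg (one_div_neg.2 (sub_neg.2 h)), Real.log_le_log_iff hQ hP,
        div_le_div_iff_of_pos_right (mul_pos hα (sub_pos.2 h))]

theorem renyiH_comp_perm {n : ℕ} (α : ℝ) (p : Fin n → ℝ) (σ : Equiv.Perm (Fin n)) :
    renyiH α (p ∘ σ) = renyiH α p := by
  unfold renyiH
  congr 1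
  · rw [← Equiv.sum_comp σ fun i => p i * Real.log (p i)]
    rfl
  · rw [← Equiv.sum_comp σ fun i => p i ^ α]
    rfl

theorem sum_comp_unif {n k : ℕ} (hkn : k ≤ n) {h : ℝ → ℝ} (h0 : h 0 = 0) :
    ∑ i, h (unif n k i) = k * h (k : ℝ)⁻¹ := by
  unfold unif
  simp only [apply_ite h, h0]
  rw [← Finset.sum_filter, Finset.sum_const, Fin.card_filter_val_lt, min_eq_right hkn,
    nsmul_eq_mul]

theorem sum_unif {n k : ℕ} (hk : 1 ≤ k) (hkn : k ≤ n) : ∑ i, unif n k i = 1 := by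
  have : (k : ℝ) ≠ 0 := by positivity
  rw [sum_comp_unif (h := fun x => x) hkn rfl, mul_inv_cancel₀ this]

theorem unif_nonneg (n k : ℕ) (i : Fin n) : 0 ≤ unif n k i := by
  unfold unif
  split_ifs <;> positivity

theorem renyiH_unif {n k : ℕ} {α : ℝ} (hα : 0 < α) (hk : 1 ≤ k) (hkn : k ≤ n) :
    renyiH α (unif n k) = Real.log k := by
  have hk0 : (0 : ℝ) < k := by positivity
  unfold renyiH
  split_ifs with h
  · rw [sum_comp_unif (h := fun x => x * Real.log x) hkn (by simp), Real.log_inv]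
    field_simp
  · have h1 : 1 - α ≠ 0 := sub_ne_zero.2 (Ne.symm h)
    rw [sum_comp_unif (h := fun x => x ^ α) hkn (Real.zero_rpow hα.ne'), Real.inv_rpow hk0.le,
      Real.log_mul hk0.ne' (inv_ne_zero (Real.rpow_pos_of_pos hk0 _).ne'), Real.log_inv,
      Real.log_rpow hk0]
    field_simp
    ring

/-- A probability vector supported on the first `k` points has entropy at most that of `U_k`. -/
theorem renyiH_le_unif {n k : ℕ} {α : ℝ} (hα : 0 < α) (hk : 1 ≤ k) (hkn : k ≤ n) {p : Fin n → ℝ}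
    (hp : ∀ i, 0 ≤ p i) (hps : ∑ i, p i = 1) (hsupp : ∀ i : Fin n, k ≤ (i : ℕ) → p i = 0) :
    renyiH α p ≤ renyiH α (unif n k) := by
  have hk0 : (0 : ℝ) < (k : ℝ)⁻¹ := by positivity
  rw [renyiH_le_iff hα hp hps (unif_nonneg n k) (sum_unif hk hkn)]
  have key : ∑ i, (renyiConvex α (unif n k i) - renyiSlope α (k : ℝ)⁻¹ * unif n k i) ≤
      ∑ i, (renyiConvex α (p i) - renyiSlope α (k : ℝ)⁻¹ * p i) := by
    refine Finset.sum_le_sum fun i _ => ?_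
    by_cases hi : (i : ℕ) < k
    · simp only [unif, if_pos hi]
      exact renyiConvex_tangent_le hα hk0 (hp i)
    · simp only [unif, if_neg hi, hsupp i (not_lt.1 hi), le_refl]
  rw [Finset.sum_sub_distrib, Finset.sum_sub_distrib, ← Finset.mul_sum, ← Finset.mul_sum, hps,
    sum_unif hk hkn] at key
  linarith

/-- The main theorem for a probability vector with nonincreasing coordinates. -/
theorem renyi_upper_bound_of_antitone {α₁ α₂ : ℝ} (hα₁ : 0 < α₁) (hα₁₂ : α₁ < α₂)
    {n k : ℕ} (hk : 1 ≤ k) (hkn : k + 1 ≤ n)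
    {p : Fin n → ℝ} (hp : ∀ i, 0 ≤ p i) (hps : ∑ i, p i = 1) (hanti : Antitone p)
    (hlow : Real.log k ≤ renyiH α₁ p) (hhigh : renyiH α₁ p < Real.log (k + 1)) :
    ∃ s ∈ Set.Icc (0 : ℝ) 1,
      renyiH α₁ (fun i => s * unif n k i + (1 - s) * unif n (k + 1) i) = renyiH α₁ p ∧
      renyiH α₂ p ≤ renyiH α₂ (fun i => s * unif n k i + (1 - s) * unif n (k + 1) i) := by
  have hα₂ : 0 < α₂ := hα₁.trans hα₁₂
  have hkn' : k ≤ n := Nat.le_of_succ_le hkn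
  have hk0 : (0 : ℝ) < k := by positivity
  set m : Fin n := ⟨k, hkn⟩
  rcases (hp m).eq_or_lt with hc | hc
  · have hsupp : ∀ i : Fin n, k ≤ (i : ℕ) → p i = 0 := fun i hi =>
      le_antisymm (hc ▸ hanti (show m ≤ i from hi)) (hp i)
    refine ⟨1, by simp, ?_, ?_⟩
    · simp only [one_mul, sub_self, zero_mul, add_zero]
      exact le_antisymm ((renyiH_unif hα₁ hk hkn').trans_le hlow)
        (renyiH_le_unif hα₁ hk hkn' hp hps hsupp)
    · simp only [one_mul, sub_self, zero_mul, add_zero]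
      exact renyiH_le_unif hα₂ hk hkn' hp hps hsupp
  set q : ℝ → Fin n → ℝ := fun s i => s * unif n k i + (1 - s) * unif n (k + 1) i with hq
  have hq_nonneg : ∀ s ∈ Set.Icc (0 : ℝ) 1, ∀ i, 0 ≤ q s i := fun s hs i =>
    add_nonneg (mul_nonneg hs.1 (unif_nonneg _ _ _))
      (mul_nonneg (sub_nonneg.2 hs.2) (unif_nonneg _ _ _))
  have hq_sum : ∀ s, ∑ i, q s i = 1 := fun s => by
    simp only [hq]
    rw [Finset.sum_add_distrib, ← Finset.mul_sum, ← Finset.mul_sum, sum_unif hk hkn',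
      sum_unif k.succ_pos hkn]
    ring
  obtain ⟨s, hs, hsΦ⟩ : ∃ s ∈ Set.Icc (0 : ℝ) 1,
      ∑ i, renyiConvex α₁ (q s i) = ∑ i, renyiConvex α₁ (p i) := by
    have hcont : Continuous fun s => ∑ i, renyiConvex α₁ (q s i) :=
      continuous_finsetSum _ fun i _ => (continuous_renyiConvex hα₁).comp (by fun_prop)
    refine intermediate_value_Icc zero_le_one hcont.continuousOn ⟨?_, ?_⟩
    · refine (renyiH_le_iff hα₁ hp hps (hq_nonneg 0 (by simp)) (hq_sum 0)).1 ?_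
      have : q 0 = unif n (k + 1) := by
        funext i
        simp [hq]
      rw [this, renyiH_unif hα₁ k.succ_pos hkn]
      push_cast
      exact hhigh.le
    · refine (renyiH_le_iff hα₁ (hq_nonneg 1 (by simp)) (hq_sum 1) hp hps).1 ?_
      have : q 1 = unif n k := by
        funext i
        simp [hq]
      rwa [this, renyiH_unif hα₁ hk hkn']
  refine ⟨s, hs, ?_, ?_⟩
  · exact le_antisymm
      ((renyiH_le_iff hα₁ (hq_nonneg s hs) (hq_sum s) hp hps).2 hsΦ.ge)
      ((renyiH_le_iff hα₁ hp hps (hq_nonneg s hs) (hq_sum s)).2 hsΦ.le)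
  refine (renyiH_le_iff hα₂ hp hps (hq_nonneg s hs) (hq_sum s)).2 ?_
  set a : ℝ := s * (k : ℝ)⁻¹ + (1 - s) * ((k + 1 : ℕ) : ℝ)⁻¹ with ha
  set b : ℝ := (1 - s) * ((k + 1 : ℕ) : ℝ)⁻¹ with hb
  have hb0 : 0 ≤ b := mul_nonneg (sub_nonneg.2 hs.2) (by positivity)
  have hba : b ≤ a := le_add_of_nonneg_left (mul_nonneg hs.1 (by positivity))
  have ha_ge : ((k + 1 : ℕ) : ℝ)⁻¹ ≤ a := by
    have h1 : ((k + 1 : ℕ) : ℝ)⁻¹ ≤ (k : ℝ)⁻¹ := by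
      refine inv_anti₀ hk0 ?_
      push_cast
      linarith
    have := mul_le_mul_of_nonneg_left h1 hs.1
    rw [ha]
    linarith
  have hca : p m < a := by
    by_contra! hle
    have hle' : ∀ i ∈ Finset.univ, unif n (k + 1) i ≤ p i := fun i _ => by
      unfold unif
      split_ifs with hi
      · exact (ha_ge.trans hle).trans (hanti (show i ≤ m from Nat.lt_succ_iff.1 hi))
      · exact hp i
    have heq := (Finset.sum_eq_sum_iff_of_le hle').1 ((sum_unif k.succ_pos hkn).trans hps.symm)
    have : unif n (k + 1) = p := funext fun i => heq i (Finset.mem_univ i)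
    rw [← this, renyiH_unif hα₁ k.succ_pos hkn] at hhigh
    push_cast at hhigh
    exact lt_irrefl _ hhigh
  obtain ⟨u, v, hL₁, hL₂, hL₃⟩ := exists_renyiConvex_combination hα₁ hα₁₂ hc hca
  set L : ℝ → ℝ := fun x => renyiConvex α₂ x - u * renyiConvex α₁ x - v * x with hL
  have key : ∑ i, L (q s i) ≤ ∑ i, L (p i) := by
    refine Finset.sum_le_sum fun i _ => ?_
    rcases lt_trichotomy (i : ℕ) k with hi | hi | hi
    · have hqi : q s i = a := by
        simp only [hq, unif, if_pos hi, if_pos (hi.trans k.lt_succ_self), ha, hb]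
      have hpi : p m ≤ p i := hanti (show i ≤ m from hi.le)
      rw [hqi]
      rcases le_total (p i) a with h | h
      · exact hL₂ ⟨hpi, h⟩ ⟨hca.le, le_rfl⟩ h
      · exact hL₃ Set.self_mem_Ici h h
    · have hqi : q s i = b := by simp [hq, unif, hi, hb]
      have him : i = m := Fin.ext hi
      rw [hqi, him]
      rcases le_total b (p m) with h | h
      · exact hL₁ ⟨hb0, h⟩ ⟨hc.le, le_rfl⟩ h
      · exact hL₂ ⟨le_rfl, hca.le⟩ ⟨h, hba⟩ h
    · have hqi : q s i = 0 := by
        simp [hq, unif, hi.not_gt, hi.not_ge]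
      have hpi : p i ≤ p m := hanti (show m ≤ i from hi.le)
      rw [hqi]
      exact hL₁ ⟨le_rfl, hc.le⟩ ⟨hp i, hpi⟩ (hp i)
  simp only [hL, Finset.sum_sub_distrib, ← Finset.mul_sum] at key
  rw [hsΦ, hq_sum, hps] at key
  linarith

theorem renyi_upper_bound_two_orders
    (α₁ α₂ : ℝ) (hα₁ : 0 < α₁) (hα₁₂ : α₁ < α₂)
    (n k : ℕ) (hk : 1 ≤ k) (hkn : k + 1 ≤ n)
    (p : Fin n → ℝ) (hp : ∀ i, 0 ≤ p i) (hps : ∑ i, p i = 1)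
    (hlow : Real.log k ≤ renyiH α₁ p) (hhigh : renyiH α₁ p < Real.log (k + 1)) :
    ∃ s ∈ Set.Icc (0 : ℝ) 1,
      renyiH α₁ (fun i => s * unif n k i + (1 - s) * unif n (k + 1) i) = renyiH α₁ p ∧
      renyiH α₂ p ≤ renyiH α₂ (fun i => s * unif n k i + (1 - s) * unif n (k + 1) i) := by
  have hanti : Antitone (p ∘ Tuple.sort fun i => -p i) := fun i j hij =>
    neg_le_neg_iff.1 (Tuple.monotone_sort (fun i => -p i) hij)
  have hsum : ∑ i, (p ∘ Tuple.sort fun i => -p i) i = 1 :=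
    (Equiv.sum_comp (Tuple.sort fun i => -p i) p).trans hps
  simpa only [renyiH_comp_perm] using
    renyi_upper_bound_of_antitone (p := p ∘ Tuple.sort fun i => -p i) hα₁ hα₁₂ hk hkn
      (fun i => hp _) hsum hanti (by rwa [renyiH_comp_perm]) (by rwa [renyiH_comp_perm])
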